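/- arXiv:math/0504566 — 2 statements merged into one kernel-verified Lean document; each statement's English description precedes it below -/
import Mathlib

section
/- Let Γ be a 2-colored right-angled Coxeter group with generating set S = A ⊔ B (elements within A pairwise non-commuting, likewise within B). Every γ ∈ Γ has a unique reduced left a-representation W = W₁a₁W₂a₂…W_r a_r W_{r+1}, where a_i ∈ A, the W_i are words in B, and the last letter of each W_i (for i ≤ r, when W_i is nonempty) does not commute with a_i. -/
/-- In a 2-colored right-angled Coxeter group (coloring `c : B → Bool`, with
`A = c⁻¹ true` and `B = c⁻¹ false`), a word is a *left a-representation* if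
whenever a letter of color `a` immediately follows a letter of color `b`, the
two letters do not commute, i.e. all letters of color `a` are moved as far left
as possible. Writing the word as `W₁a₁W₂a₂…W_r a_r W_{r+1}` with `aᵢ` of color
`a` and the `Wᵢ` words of color `b`, this says exactly that the last letter of
each nonempty coefficient `Wᵢ` (`i ≤ r`) does not commute with `aᵢ`. -/
def IsLeftARep {B : Type*} (M : CoxeterMatrix B) (c : B → Bool) (w : List B) : Prop :=
  ∀ (l : List B) (x y : B) (r : List B),
    w = l ++ x :: y :: r → c y = true → c x = false → M x y = 0

namespace RightAngledCoxeter

variable {B : Type*} {W : Type*} [Group W] {M : CoxeterMatrix B}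

/-- Two letters may be adjacent in a normal form: they differ, and they are not a commuting pair
consisting of a letter of color `b` followed by a letter of color `a`. -/
def Admissible (M : CoxeterMatrix B) (c : B → Bool) (x y : B) : Prop :=
  x ≠ y ∧ (c y = true → c x = false → M x y = 0)

open Classical in
/-- Left multiplication of a normal form by a generator. -/
noncomputable def leftMul (M : CoxeterMatrix B) (c : B → Bool) (s : B) : List B → List B
  | [] => [s]
  | x :: w =>
    if x = s then w
    else if c s = false ∧ c x = true ∧ M s x = 2 then x :: leftMul M c s w
    else s :: x :: w

theorem isChain_cons_leftMul {c : B → Bool} (hra : ∀ s t : B, s ≠ t → M s t = 0 ∨ M s t = 2)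
    {s : B} (hs : c s = false) (w : List B) {x : B} (hx : c x = true) (hsx : M s x = 2)
    (hw : (x :: w).IsChain (Admissible M c)) :
    (x :: leftMul M c s w).IsChain (Admissible M c) := by
  induction w generalizing x with
  | nil =>
    simp only [leftMul, List.isChain_cons_cons, List.isChain_singleton, and_true]
    exact ⟨by grind, by grind⟩
  | cons y w ih =>
    rw [List.isChain_cons_cons] at hw
    unfold leftMul
    split_ifs with h1 h2
    · subst h1
      cases w with
      | nil => simp
      | cons z w =>
        simp only [List.isChain_cons_cons, Admissible] at hw ⊢
        grind
    · exact List.isChain_cons_cons.2 ⟨hw.1, ih h2.2.1 h2.2.2 hw.2⟩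
    · simp only [List.isChain_cons_cons]
      refine ⟨⟨by grind, by grind⟩, ⟨by grind, ?_⟩, hw.2⟩
      have := hra s y (by grind)
      grind

theorem isChain_leftMul {c : B → Bool} (hra : ∀ s t : B, s ≠ t → M s t = 0 ∨ M s t = 2)
    (s : B) {w : List B} (hw : w.IsChain (Admissible M c)) :
    (leftMul M c s w).IsChain (Admissible M c) := by
  cases w with
  | nil => simp [leftMul]
  | cons y w =>
    unfold leftMul
    split_ifs with h1 h2
    · exact hw.tail
    · exact isChain_cons_leftMul hra h2.1 w h2.2.1 h2.2.2 hw
    · refine List.isChain_cons_cons.2 ⟨⟨by grind, ?_⟩, hw⟩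
      have := hra s y (by grind)
      grind

theorem leftMul_of_isChain_cons {c : B → Bool} {s : B} {w : List B}
    (hw : (s :: w).IsChain (Admissible M c)) : leftMul M c s w = s :: w := by
  cases w with
  | nil => rfl
  | cons y w =>
    simp only [List.isChain_cons_cons, Admissible] at hw
    unfold leftMul
    grind

theorem leftMul_leftMul_self {c : B → Bool} (s : B) {w : List B}
    (hw : w.IsChain (Admissible M c)) : leftMul M c s (leftMul M c s w) = w := by
  induction w with
  | nil => simp [leftMul]
  | cons y w ih =>
    rw [leftMul]
    split_ifs with h1 h2
    · subst h1
      exact leftMul_of_isChain_cons hw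
    · rw [leftMul, if_neg h1, if_pos h2, ih hw.tail]
    · simp [leftMul]

theorem leftMul_comm {c : B → Bool} {s t : B} (hs : c s = false) (ht : c t = true)
    (hst : M s t = 2) {w : List B} (hw : w.IsChain (Admissible M c)) :
    leftMul M c s (leftMul M c t w) = leftMul M c t (leftMul M c s w) := by
  have hne : t ≠ s := by grind
  cases w with
  | nil => simp [leftMul, hs, ht, hst, hne, hne.symm]
  | cons y w =>
    by_cases hy : y = t
    · subst hy
      simp [leftMul, hs, ht, hst, hne]
    · by_cases hys : y = s
      · subst hys
        cases w with
        | nil => simp [leftMul, hs, ht, hst, hne, hne.symm]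
        | cons z w =>
          simp only [List.isChain_cons_cons, Admissible] at hw
          have hz : z ≠ t := by grind
          simp [leftMul, hs, ht, hst, hne, hne.symm, hz]
      · simp only [leftMul, hs, ht, hy, hys]
        grind [leftMul]

theorem length_leftMul_le (c : B → Bool) (s : B) (w : List B) :
    (leftMul M c s w).length ≤ w.length + 1 := by
  induction w with
  | nil => simp [leftMul]
  | cons y w ih =>
    unfold leftMul
    split_ifs <;> simp <;> omega

theorem simple_mul_simple_comm (cs : CoxeterSystem M W) {s t : B} (h : M s t = 2) :
    cs.simple s * cs.simple t = cs.simple t * cs.simple s := by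
  have := cs.simple_mul_simple_pow s t
  rw [h, pow_two] at this
  simpa using eq_inv_of_mul_eq_one_left this

theorem wordProd_leftMul (cs : CoxeterSystem M W) (c : B → Bool) (s : B) (w : List B) :
    cs.wordProd (leftMul M c s w) = cs.simple s * cs.wordProd w := by
  induction w with
  | nil => simp [leftMul]
  | cons y w ih =>
    unfold leftMul
    split_ifs with h1 h2
    · simp [h1, cs.wordProd_cons]
    · rw [cs.wordProd_cons, ih, cs.wordProd_cons, ← mul_assoc, ← mul_assoc,
        simple_mul_simple_comm cs h2.2.2]
    · simp [cs.wordProd_cons]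

/-- Left multiplication by a generator, as a permutation of the set of normal forms. -/
noncomputable def leftMulPerm {c : B → Bool}
    (hra : ∀ s t : B, s ≠ t → M s t = 0 ∨ M s t = 2) (s : B) :
    Equiv.Perm {w : List B // w.IsChain (Admissible M c)} :=
  Function.Involutive.toPerm (fun w => ⟨leftMul M c s w, isChain_leftMul hra s w.2⟩)
    fun w => Subtype.ext (leftMul_leftMul_self s w.2)

theorem leftMulPerm_mul_self {c : B → Bool}
    (hra : ∀ s t : B, s ≠ t → M s t = 0 ∨ M s t = 2) (s : B) :
    leftMulPerm (c := c) hra s * leftMulPerm hra s = 1 :=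
  Equiv.ext fun w => Subtype.ext (leftMul_leftMul_self s w.2)

theorem leftMulPerm_comm {c : B → Bool}
    (hra : ∀ s t : B, s ≠ t → M s t = 0 ∨ M s t = 2)
    (hcolor : ∀ s t : B, s ≠ t → c s = c t → M s t = 0) {s t : B} (hst : M s t = 2) :
    Commute (leftMulPerm (c := c) hra s) (leftMulPerm hra t) := by
  have hne : s ≠ t := by
    rintro rfl
    simp at hst
  have hc : c s ≠ c t := fun h => by simp [hcolor s t hne h] at hst
  refine Equiv.ext fun w => Subtype.ext ?_
  cases hs : c s with
  | false => exact leftMul_comm hs (by grind) hst w.2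
  | true => exact (leftMul_comm (by grind) hs (M.symmetric t s ▸ hst) w.2).symm

theorem isLiftable_leftMulPerm {c : B → Bool}
    (hra : ∀ s t : B, s ≠ t → M s t = 0 ∨ M s t = 2)
    (hcolor : ∀ s t : B, s ≠ t → c s = c t → M s t = 0) :
    M.IsLiftable (leftMulPerm (c := c) hra) := by
  intro s t
  by_cases h : s = t
  · subst h
    simp [leftMulPerm_mul_self]
  · obtain h0 | h2 := hra s t h
    · simp [h0]
    · rw [h2, (leftMulPerm_comm hra hcolor h2).mul_pow, pow_two, pow_two,
        leftMulPerm_mul_self, leftMulPerm_mul_self, one_mul]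

theorem foldr_leftMul_of_isChain {c : B → Bool} {w : List B}
    (hw : w.IsChain (Admissible M c)) : w.foldr (leftMul M c) [] = w := by
  induction w with
  | nil => rfl
  | cons s w ih => rw [List.foldr_cons, ih hw.tail, leftMul_of_isChain_cons hw]

theorem isChain_foldr_leftMul {c : B → Bool}
    (hra : ∀ s t : B, s ≠ t → M s t = 0 ∨ M s t = 2) (w : List B) :
    (w.foldr (leftMul M c) []).IsChain (Admissible M c) := by
  induction w with
  | nil => simp
  | cons s w ih => exact isChain_leftMul hra s ih

theorem wordProd_foldr_leftMul (cs : CoxeterSystem M W) (c : B → Bool) (w : List B) :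
    cs.wordProd (w.foldr (leftMul M c) []) = cs.wordProd w := by
  induction w with
  | nil => rfl
  | cons s w ih => rw [List.foldr_cons, wordProd_leftMul, ih, cs.wordProd_cons]

theorem length_foldr_leftMul_le (c : B → Bool) (w : List B) :
    (w.foldr (leftMul M c) []).length ≤ w.length := by
  induction w with
  | nil => simp
  | cons s w ih =>
    have := length_leftMul_le (M := M) c s (w.foldr (leftMul M c) [])
    simp only [List.foldr_cons, List.length_cons]
    omega

theorem lift_wordProd_apply_nil (cs : CoxeterSystem M W) {c : B → Bool}
    (hra : ∀ s t : B, s ≠ t → M s t = 0 ∨ M s t = 2)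
    (hcolor : ∀ s t : B, s ≠ t → c s = c t → M s t = 0) (w : List B) :
    (cs.lift ⟨leftMulPerm (c := c) hra, isLiftable_leftMulPerm hra hcolor⟩ (cs.wordProd w)
      ⟨[], List.isChain_nil⟩ : List B) = w.foldr (leftMul M c) [] := by
  induction w with
  | nil => simp
  | cons s w ih =>
    rw [cs.wordProd_cons, map_mul, cs.lift_apply_simple, List.foldr_cons, ← ih]
    rfl

theorem foldr_leftMul_eq_of_wordProd_eq (cs : CoxeterSystem M W) {c : B → Bool}
    (hra : ∀ s t : B, s ≠ t → M s t = 0 ∨ M s t = 2)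
    (hcolor : ∀ s t : B, s ≠ t → c s = c t → M s t = 0) {v w : List B}
    (h : cs.wordProd v = cs.wordProd w) :
    v.foldr (leftMul M c) [] = w.foldr (leftMul M c) [] := by
  rw [← lift_wordProd_apply_nil cs hra hcolor, h, lift_wordProd_apply_nil cs hra hcolor]

theorem isLeftARep_of_isChain {c : B → Bool} {w : List B}
    (hw : w.IsChain (Admissible M c)) : IsLeftARep M c w := by
  rintro l x y r rfl
  exact (List.isChain_cons_cons.1 hw.right_of_append).1.2

theorem isChain_of_isReduced_of_isLeftARep (cs : CoxeterSystem M W) {c : B → Bool} {w : List B}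
    (hred : cs.IsReduced w) (hrep : IsLeftARep M c w) : w.IsChain (Admissible M c) := by
  refine List.isChain_iff_forall_rel_of_append_cons_cons.2 fun x y l r h => ⟨?_, hrep l x y r h⟩
  rintro rfl
  have h1 : cs.wordProd w = cs.wordProd (l ++ r) := by
    simp [h, cs.wordProd_append, cs.wordProd_cons]
  have h2 := cs.length_wordProd_le (l ++ r)
  rw [← h1, hred, h] at h2
  simp at h2

end RightAngledCoxeter

/-- In a 2-colored right-angled Coxeter group (elements of
each color pairwise non-commuting), every group element has a unique reduced
left a-representation. -/
theorem racg_unique_canonical_a_representation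
    {B : Type*} {W : Type*} [Group W] {M : CoxeterMatrix B}
    (cs : CoxeterSystem M W)
    (hra : ∀ s t : B, s ≠ t → M s t = 0 ∨ M s t = 2)
    (c : B → Bool)
    (hcolor : ∀ s t : B, s ≠ t → c s = c t → M s t = 0)
    (γ : W) :
    ∃! w : List B, cs.IsReduced w ∧ cs.wordProd w = γ ∧ IsLeftARep M c w := by
  obtain ⟨v, hv, rfl⟩ := cs.exists_isReduced γ
  refine ⟨v.foldr (RightAngledCoxeter.leftMul M c) [], ⟨?_, ?_, ?_⟩, ?_⟩
  · refine le_antisymm (cs.length_wordProd_le _) ?_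
    rw [RightAngledCoxeter.wordProd_foldr_leftMul, hv]
    exact RightAngledCoxeter.length_foldr_leftMul_le c v
  · exact RightAngledCoxeter.wordProd_foldr_leftMul cs c v
  · exact RightAngledCoxeter.isLeftARep_of_isChain
      (RightAngledCoxeter.isChain_foldr_leftMul hra v)
  · rintro w ⟨hred, hw, hrep⟩
    rw [← RightAngledCoxeter.foldr_leftMul_eq_of_wordProd_eq cs hra hcolor hw]
    exact (RightAngledCoxeter.foldr_leftMul_of_isChain
      (RightAngledCoxeter.isChain_of_isReduced_of_isLeftARep cs hred hrep)).symm
end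

section
/- Let Γ be a hyperbolic (no-square) 2-colored right-angled Coxeter group with S = A ⊔ B. Suppose U = U₁a₁⋯U_p a_p U_{p+1} and V = V_{p+1}a_{p+1}⋯ are canonical a-representations such that UV is reduced, and let U_R be the set of letters of U moved to the right of a_{p+1} in the canonical a-representation of UV. If the coefficient V_{p+1} of a_{p+1} in V is nonempty, then U_R is empty and UV is already the canonical a-representation. -/
/-- Siebenmann's no-square condition: there are no `t₁, t₂, s₁, s₂` in the
generating set such that each `sᵢ` commutes with each `tⱼ` while `s₁, s₂` do
not commute and `t₁, t₂` do not commute. -/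
def HasNoSquare {B : Type*} (M : CoxeterMatrix B) : Prop :=
  ¬ ∃ s₁ s₂ t₁ t₂ : B,
      M s₁ t₁ = 2 ∧ M s₁ t₂ = 2 ∧ M s₂ t₁ = 2 ∧ M s₂ t₂ = 2 ∧
      s₁ ≠ s₂ ∧ M s₁ s₂ = 0 ∧ t₁ ≠ t₂ ∧ M t₁ t₂ = 0

namespace RightAngled

variable {B : Type*} {M : CoxeterMatrix B}

/-- Equality of words up to swapping adjacent commuting letters. -/
inductive Sim (M : CoxeterMatrix B) : List B → List B → Prop
  | refl (u : List B) : Sim M u u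
  | symm {u v : List B} : Sim M u v → Sim M v u
  | trans {u v w : List B} : Sim M u v → Sim M v w → Sim M u w
  | cons (s : B) {u v : List B} : Sim M u v → Sim M (s :: u) (s :: v)
  | swap {s t : B} (u : List B) : M s t = 2 → Sim M (s :: t :: u) (t :: s :: u)

theorem Sim.length_eq {u v : List B} (h : Sim M u v) : u.length = v.length := by
  induction h <;> simp_all

theorem Sim.wordProd_eq {W : Type*} [Group W] (cs : CoxeterSystem M W) {u v : List B}
    (h : Sim M u v) : cs.wordProd u = cs.wordProd v := by
  induction h with
  | refl => rfl
  | symm _ ih => exact ih.symm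
  | trans _ _ ih₁ ih₂ => exact ih₁.trans ih₂
  | cons s _ ih => simp only [cs.wordProd_cons, ih]
  | @swap s t u h =>
    have hst : cs.simple s * cs.simple t = cs.simple t * cs.simple s := by
      have := cs.simple_mul_simple_pow s t
      rw [h, pow_two] at this
      simpa using eq_inv_of_mul_eq_one_left this
    simp only [cs.wordProd_cons, ← mul_assoc, hst]

open Classical in
/-- The word left after commuting a letter `s` of a word to the front and deleting it there,
if this is possible. -/
noncomputable def extract (M : CoxeterMatrix B) (s : B) : List B → Option (List B)
  | [] => none
  | t :: u => if s = t then some u else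
      if M s t = 2 then (extract M s u).map (t :: ·) else none

theorem ne_of_apply_eq_two {s t : B} (h : M s t = 2) : s ≠ t := by
  rintro rfl
  simp at h

theorem extract_cons_self (s : B) (u : List B) : extract M s (s :: u) = some u := by
  simp [extract]

theorem extract_cons_of_commute {s t : B} (h : M s t = 2) (u : List B) :
    extract M s (t :: u) = (extract M s u).map (t :: ·) := by
  simp [extract, ne_of_apply_eq_two h, h]

theorem sim_cons_of_extract {s : B} {u v : List B} (h : extract M s u = some v) :
    Sim M u (s :: v) := by
  induction u generalizing v with
  | nil => simp [extract] at h
  | cons t u ih =>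
    by_cases hst : s = t
    · subst hst
      rw [extract_cons_self, Option.some_inj] at h
      exact h ▸ .refl _
    by_cases h2 : M s t = 2
    · rw [extract_cons_of_commute h2, Option.map_eq_some_iff] at h
      obtain ⟨q, hq, rfl⟩ := h
      exact (Sim.cons t (ih hq)).trans (.swap q (M.symmetric s t ▸ h2))
    · simp [extract, hst, h2] at h

theorem optionRel_map_cons (t : B) {o₁ o₂ : Option (List B)} (h : Option.Rel (Sim M) o₁ o₂) :
    Option.Rel (Sim M) (o₁.map (t :: ·)) (o₂.map (t :: ·)) := by
  cases h with
  | none => exact .none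
  | some h => exact .some (.cons t h)

theorem optionRel_refl (o : Option (List B)) : Option.Rel (Sim M) o o := by
  cases o with
  | none => exact .none
  | some u => exact .some (.refl u)

theorem optionRel_symm {o₁ o₂ : Option (List B)} (h : Option.Rel (Sim M) o₁ o₂) :
    Option.Rel (Sim M) o₂ o₁ := by
  cases h with
  | none => exact .none
  | some h => exact .some h.symm

theorem optionRel_trans {o₁ o₂ o₃ : Option (List B)} (h : Option.Rel (Sim M) o₁ o₂)
    (h' : Option.Rel (Sim M) o₂ o₃) : Option.Rel (Sim M) o₁ o₃ := by
  cases h with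
  | none => exact h'
  | some h => cases h' with
    | some h' => exact .some (h.trans h')

theorem Sim.extract {u v : List B} (h : Sim M u v) (s : B) :
    Option.Rel (Sim M) (extract M s u) (extract M s v) := by
  induction h with
  | refl u => exact optionRel_refl _
  | symm _ ih => exact optionRel_symm ih
  | trans _ _ ih₁ ih₂ => exact optionRel_trans ih₁ ih₂
  | cons t h ih =>
    by_cases hst : s = t
    · subst hst
      simpa only [extract_cons_self] using .some h
    by_cases h2 : M s t = 2
    · simpa only [extract_cons_of_commute h2] using optionRel_map_cons t ih
    · simpa only [RightAngled.extract, hst, h2, if_false] using .none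
  | @swap a b u hab =>
    have hba : M b a = 2 := M.symmetric a b ▸ hab
    by_cases hsa : s = a
    · subst hsa
      rw [extract_cons_self, extract_cons_of_commute hab, extract_cons_self]
      exact .some (.refl _)
    by_cases hsb : s = b
    · subst hsb
      rw [extract_cons_self, extract_cons_of_commute hba, extract_cons_self]
      exact .some (.refl _)
    by_cases ha : M s a = 2
    · by_cases hb : M s b = 2
      · simp only [extract_cons_of_commute ha, extract_cons_of_commute hb]
        cases RightAngled.extract M s u with
        | none => exact .none
        | some v => exact .some (.swap v hab)
      · simp [RightAngled.extract, hsa, hsb, ha, hb]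
    · simp [RightAngled.extract, hsa, hsb, ha]

theorem Sim.extract_eq_none_iff {u v : List B} (h : Sim M u v) (s : B) :
    RightAngled.extract M s u = none ↔ RightAngled.extract M s v = none := by
  have := h.extract s
  revert this
  generalize RightAngled.extract M s u = a
  generalize RightAngled.extract M s v = b
  rintro (_ | _) <;> simp

/-- No two equal letters of the word can be brought next to each other by commutations. -/
def CommReduced (M : CoxeterMatrix B) : List B → Prop
  | [] => True
  | s :: u => extract M s u = none ∧ CommReduced M u

theorem Sim.commReduced_iff {u v : List B} (h : Sim M u v) :
    CommReduced M u ↔ CommReduced M v := by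
  induction h with
  | refl => rfl
  | symm _ ih => exact ih.symm
  | trans _ _ ih₁ ih₂ => exact ih₁.trans ih₂
  | cons s h ih => simp only [CommReduced, h.extract_eq_none_iff s, ih]
  | @swap a b u hab =>
    have hba : M b a = 2 := M.symmetric a b ▸ hab
    simp only [CommReduced, extract_cons_of_commute hab, extract_cons_of_commute hba,
      Option.map_eq_none_iff]
    tauto

/-- Left multiplication of a word by a letter, cancelling when possible. -/
noncomputable def toggle (M : CoxeterMatrix B) (s : B) (u : List B) : List B :=
  (extract M s u).getD (s :: u)

theorem toggle_of_some {s : B} {u v : List B} (h : extract M s u = some v) :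
    toggle M s u = v := by simp [toggle, h]

theorem toggle_of_none {s : B} {u : List B} (h : extract M s u = none) :
    toggle M s u = s :: u := by simp [toggle, h]

theorem CommReduced.toggle {u : List B} (h : CommReduced M u) (s : B) :
    CommReduced M (toggle M s u) := by
  cases hs : extract M s u with
  | none =>
    rw [toggle_of_none hs]
    exact ⟨hs, h⟩
  | some v =>
    rw [toggle_of_some hs]
    exact ((sim_cons_of_extract hs).commReduced_iff.1 h).2

theorem Sim.toggle {u v : List B} (h : Sim M u v) (s : B) :
    Sim M (toggle M s u) (toggle M s v) := by
  have := h.extract s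
  unfold RightAngled.toggle
  revert this
  generalize RightAngled.extract M s u = a
  generalize RightAngled.extract M s v = b
  intro hab
  cases hab with
  | none => exact .cons s h
  | some hab => exact hab

theorem sim_toggle_toggle {u : List B} (h : CommReduced M u) (s : B) :
    Sim M (toggle M s (toggle M s u)) u := by
  cases hs : extract M s u with
  | none =>
    rw [toggle_of_none hs, toggle_of_some (extract_cons_self s u)]
    exact .refl u
  | some v =>
    have hv := sim_cons_of_extract hs
    rw [toggle_of_some hs, toggle_of_none (hv.commReduced_iff.1 h).1]
    exact hv.symm

theorem sim_toggle_toggle_of_none {s t : B} (h : M s t = 2) {u : List B}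
    (hs : extract M s u = none) :
    Sim M (toggle M s (toggle M t u)) (toggle M t (toggle M s u)) := by
  have h' : M t s = 2 := M.symmetric s t ▸ h
  rw [toggle_of_none hs]
  cases ht : extract M t u with
  | none =>
    rw [toggle_of_none ht, toggle_of_none (by simp [extract_cons_of_commute h, hs]),
      toggle_of_none (by simp [extract_cons_of_commute h', ht])]
    exact .swap u h
  | some v =>
    have hsv : extract M s v = none := by
      have := ((sim_cons_of_extract ht).extract_eq_none_iff s).1 hs
      simpa [extract_cons_of_commute h] using this
    rw [toggle_of_some ht, toggle_of_none hsv, toggle_of_some (v := s :: v)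
      (by simp [extract_cons_of_commute h', ht])]
    exact .refl _

theorem sim_toggle_comm {s t : B} (h : M s t = 2) {u : List B} (hu : CommReduced M u) :
    Sim M (toggle M s (toggle M t u)) (toggle M t (toggle M s u)) := by
  cases hs : extract M s u with
  | none => exact sim_toggle_toggle_of_none h hs
  | some v =>
    have huv := sim_cons_of_extract hs
    have hsv : extract M s v = none := (huv.commReduced_iff.1 hu).1
    have huv' : Sim M u (toggle M s v) := by rwa [toggle_of_none hsv]
    have hv : CommReduced M v := (huv.commReduced_iff.1 hu).2
    rw [toggle_of_some hs]
    exact (((huv'.toggle t).trans (sim_toggle_toggle_of_none h hsv).symm).toggle s).trans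
      (sim_toggle_toggle (hv.toggle t) s)

/-- Words reduced under commutations, up to commutations. -/
def traceSetoid (M : CoxeterMatrix B) : Setoid {u : List B // CommReduced M u} where
  r u v := Sim M u.1 v.1
  iseqv := ⟨fun u => .refl u.1, .symm, .trans⟩

/-- The action of a letter on classes of words reduced under commutations. -/
noncomputable def toggleTrace (M : CoxeterMatrix B) (s : B) :
    Function.End (Quotient (traceSetoid M)) :=
  Quotient.map (fun u => ⟨toggle M s u.1, u.2.toggle s⟩) fun _ _ h => Sim.toggle h s

theorem toggleTrace_mul_self (s : B) : toggleTrace M s * toggleTrace M s = 1 := by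
  funext q
  induction q using Quotient.inductionOn with
  | h u => exact Quotient.sound (sim_toggle_toggle u.2 s)

theorem toggleTrace_comm {s t : B} (h : M s t = 2) :
    toggleTrace M s * toggleTrace M t = toggleTrace M t * toggleTrace M s := by
  funext q
  induction q using Quotient.inductionOn with
  | h u => exact Quotient.sound (sim_toggle_comm h u.2)

theorem isLiftable_toggleTrace (hra : ∀ s t : B, s ≠ t → M s t = 0 ∨ M s t = 2) :
    M.IsLiftable (toggleTrace M) := by
  intro s t
  by_cases hst : s = t
  · subst hst
    rw [toggleTrace_mul_self, one_pow]
  rcases hra s t hst with h | h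
  · rw [h, pow_zero]
  · rw [h, pow_two]
    nth_rewrite 2 [toggleTrace_comm h]
    rw [mul_assoc, ← mul_assoc (toggleTrace M t), toggleTrace_mul_self, one_mul,
      toggleTrace_mul_self]

section CoxeterSystem

variable {W : Type*} [Group W] (cs : CoxeterSystem M W)

theorem isReduced_of_cons {s : B} {u : List B} (h : cs.IsReduced (s :: u)) :
    cs.IsReduced u := by
  simpa using h.drop 1

theorem extract_eq_none_of_isReduced_cons {s : B} {u : List B} (h : cs.IsReduced (s :: u)) :
    extract M s u = none := by
  by_contra hne
  obtain ⟨v, hv⟩ := Option.ne_none_iff_exists'.1 hne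
  have hsim := sim_cons_of_extract hv
  have hprod : cs.wordProd (s :: u) = cs.wordProd v := by
    rw [cs.wordProd_cons, hsim.wordProd_eq cs, cs.wordProd_cons, cs.simple_mul_simple_cancel_left]
  have hle := cs.length_wordProd_le v
  rw [← hprod, h] at hle
  have := hsim.length_eq
  simp only [List.length_cons] at hle this
  omega

theorem lift_toggleTrace_wordProd (hra : ∀ s t : B, s ≠ t → M s t = 0 ∨ M s t = 2)
    {u : List B} (h : cs.IsReduced u) :
    ∃ hu : CommReduced M u, cs.lift ⟨toggleTrace M, isLiftable_toggleTrace hra⟩ (cs.wordProd u)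
      (Quotient.mk (traceSetoid M) ⟨[], trivial⟩) = Quotient.mk (traceSetoid M) ⟨u, hu⟩ := by
  induction u with
  | nil => exact ⟨trivial, by rw [cs.wordProd_nil, map_one]; rfl⟩
  | cons s u ih =>
    obtain ⟨hu, ih⟩ := ih (isReduced_of_cons cs h)
    have hs := extract_eq_none_of_isReduced_cons cs h
    refine ⟨⟨hs, hu⟩, ?_⟩
    rw [cs.wordProd_cons, map_mul, cs.lift_apply_simple]
    refine (congrArg (toggleTrace M s) ih).trans (Quotient.sound ?_)
    change Sim M (toggle M s u) (s :: u)
    rw [toggle_of_none hs]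
    exact .refl _

/-- Reduced words of the same element of a right-angled Coxeter group differ by commutations. -/
theorem sim_of_isReduced (hra : ∀ s t : B, s ≠ t → M s t = 0 ∨ M s t = 2) {u v : List B}
    (hu : cs.IsReduced u) (hv : cs.IsReduced v) (h : cs.wordProd u = cs.wordProd v) :
    Sim M u v := by
  obtain ⟨_, hu'⟩ := lift_toggleTrace_wordProd cs hra hu
  obtain ⟨_, hv'⟩ := lift_toggleTrace_wordProd cs hra hv
  rw [h, hv'] at hu'
  exact (Quotient.exact hu').symm

end CoxeterSystem

theorem isLeftARep_of_cons {c : B → Bool} {s : B} {u : List B}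
    (h : IsLeftARep M c (s :: u)) : IsLeftARep M c u :=
  fun l x y r hu => h (s :: l) x y r (by rw [hu, List.cons_append])

theorem IsLeftARep.append {c : B → Bool} {x : B} {u v : List B} (hu : IsLeftARep M c u)
    (hv : IsLeftARep M c (x :: v)) (hx : c x = false) : IsLeftARep M c (u ++ x :: v) := by
  intro l y z r h hz hy
  rcases List.append_eq_append_iff.1 h with ⟨m, rfl, hm⟩ | ⟨m, rfl, hm⟩
  · exact hv m y z r hm hz hy
  · match m, hm with
    | [], hm => exact hv [] y z r hm.symm hz hy
    | [y'], hm =>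
      simp only [List.cons_append, List.nil_append, List.cons.injEq] at hm
      rw [hm.2.1, hx] at hz
      contradiction
    | y' :: z' :: m, hm =>
      simp only [List.cons_append, List.cons.injEq] at hm
      obtain ⟨rfl, rfl, -⟩ := hm
      exact hu l y z m rfl hz hy

theorem head_eq_of_extract_ne_none {c : B → Bool}
    (hcolor : ∀ s t : B, s ≠ t → c s = c t → M s t = 0) {s : B} (hs : c s = true)
    {u : List B} (hu : IsLeftARep M c u) (h : extract M s u ≠ none) : ∃ v, u = s :: v := by
  induction u with
  | nil => simp [extract] at h
  | cons t u ih =>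
    by_cases hst : s = t
    · exact ⟨u, by rw [hst]⟩
    by_cases h2 : M s t = 2
    · rw [extract_cons_of_commute h2, Ne, Option.map_eq_none_iff] at h
      obtain ⟨v, rfl⟩ := ih (isLeftARep_of_cons hu) h
      have ht : c t = false := by
        by_contra ht
        have := hcolor s t hst (by simp_all)
        omega
      have := hu [] t s v rfl hs ht
      rw [M.symmetric t s] at this
      omega
    · simp [extract, hst, h2] at h

/-- Reduced left a-representations of the same element coincide. -/
theorem eq_of_isLeftARep {W : Type*} [Group W] (cs : CoxeterSystem M W)
    (hra : ∀ s t : B, s ≠ t → M s t = 0 ∨ M s t = 2) {c : B → Bool}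
    (hcolor : ∀ s t : B, s ≠ t → c s = c t → M s t = 0) {u v : List B}
    (hu : cs.IsReduced u) (hv : cs.IsReduced v) (hu' : IsLeftARep M c u)
    (hv' : IsLeftARep M c v) (h : cs.wordProd u = cs.wordProd v) : u = v := by
  induction u generalizing v with
  | nil =>
    have := (sim_of_isReduced cs hra hu hv h).length_eq
    exact (List.length_eq_zero_iff.1 this.symm).symm
  | cons s u ih =>
    have hsim := sim_of_isReduced cs hra hu hv h
    obtain _ | ⟨t, v⟩ := v
    · simpa using hsim.length_eq
    have hst : s = t := by
      have hs : extract M s (t :: v) ≠ none :=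
        mt (hsim.extract_eq_none_iff s).2 (by simp [extract_cons_self])
      have ht : extract M t (s :: u) ≠ none :=
        mt (hsim.extract_eq_none_iff t).1 (by simp [extract_cons_self])
      by_contra hst
      have h2 : M s t = 2 := by
        by_contra h2
        simp [extract, hst, h2] at hs
      have hne : c s ≠ c t := fun hc => by
        have := hcolor s t hst hc
        omega
      cases hcs : c s with
      | true =>
        obtain ⟨w, hw⟩ := head_eq_of_extract_ne_none hcolor hcs hv' hs
        exact hst (List.cons.inj hw).1.symm
      | false =>
        have hct : c t = true := by simp_all
        obtain ⟨w, hw⟩ := head_eq_of_extract_ne_none hcolor hct hu' ht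
        exact hst (List.cons.inj hw).1
    subst hst
    rw [cs.wordProd_cons, cs.wordProd_cons, mul_right_inj] at h
    rw [ih (isReduced_of_cons cs hu) (isReduced_of_cons cs hv) (isLeftARep_of_cons hu')
      (isLeftARep_of_cons hv') h]

end RightAngled

/-- Let `Γ` be a hyperbolic (no-square) 2-colored
right-angled Coxeter group and let `U`, `V` be canonical a-representations with
`UV` reduced. If the coefficient `V_{p+1}` of the first `a`-letter `a_{p+1}` of
`V` is nonempty (the first letter of `V` has color `b` and `V` contains an
`a`-letter), then no letter of `U` is moved to the right of `a_{p+1}`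
(`U_R = ∅`) and `UV` is already the canonical a-representation of its product:
it is a left a-representation, and it coincides with any canonical
a-representation of the same group element. -/
theorem racg_composition_nonempty_coefficient
    {B : Type*} {W : Type*} [Group W] {M : CoxeterMatrix B}
    (cs : CoxeterSystem M W)
    (hra : ∀ s t : B, s ≠ t → M s t = 0 ∨ M s t = 2)
    (hhyp : HasNoSquare M)
    (c : B → Bool)
    (hcolor : ∀ s t : B, s ≠ t → c s = c t → M s t = 0)
    (U V : List B)
    (hU : cs.IsReduced U ∧ IsLeftARep M c U)
    (hV : cs.IsReduced V ∧ IsLeftARep M c V)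
    (hUV : cs.IsReduced (U ++ V))
    (hVfirst : ∃ (x : B) (V' : List B), V = x :: V' ∧ c x = false)
    (hVa : ∃ y ∈ V, c y = true) :
    IsLeftARep M c (U ++ V) ∧
      ∀ w : List B, cs.IsReduced w → IsLeftARep M c w →
        cs.wordProd w = cs.wordProd (U ++ V) → w = U ++ V := by
  obtain ⟨x, V', rfl, hx⟩ := hVfirst
  have hrep := RightAngled.IsLeftARep.append hU.2 hV.2 hx
  exact ⟨hrep, fun w hw hw' h => RightAngled.eq_of_isLeftARep cs hra hcolor hw hUV hw' hrep h⟩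
end
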